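/- Let K be a non-cyclic cubic field with Galois closure K̃, and let p be an odd prime. Then v_p(Disc(K̃)) = 2·v_p(Disc(K)) if v_p(Disc(K)) is even, and v_p(Disc(K̃)) = 2·v_p(Disc(K)) + 1 if v_p(Disc(K)) is odd, where v_p denotes the exponent of p in the discriminant of the ring of integers. -/

import Mathlib

open NumberField

lemma exists_sqrt_discr
    (K Kt : Type) [Field K] [NumberField K] [Field Kt] [NumberField Kt]
    [Algebra K Kt] [IsScalarTower ℚ K Kt]
    (hK3 : Module.finrank ℚ K = 3) (hKnotGal : ¬IsGalois ℚ K)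
    (hGal : IsGalois ℚ Kt) :
    ∃ δ : Kt, δ ^ 2 = ((discr K : ℤ) : Kt) ∧ δ ∉ Set.range (algebraMap K Kt) := by
  classical
  let E := AlgebraicClosure Kt
  let pb := Field.powerBasisOfFiniteOfSeparable ℚ K
  have hdim : pb.dim = 3 := by rw [← hK3, pb.finrank]
  set α := pb.gen with hα
  let b : Module.Basis (Fin 3) ℚ K := pb.basis.reindex (finCongr hdim)
  have hb : ∀ i, b i = α ^ (i : ℕ) := by
    intro i
    simp [b, hα]
  have hcard : Fintype.card (K →ₐ[ℚ] E) = 3 := by rw [AlgHom.card, hK3]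
  let ι : K →ₐ[ℚ] E := IsScalarTower.toAlgHom ℚ K E
  obtain ⟨e, he0⟩ : ∃ e : Fin 3 ≃ (K →ₐ[ℚ] E), e 0 = ι := by
    let e := (Fintype.equivFinOfCardEq hcard).symm
    refine ⟨(Equiv.swap 0 (e.symm ι)).trans e, by simp⟩
  have hι : ∀ k, ι k = algebraMap Kt E (algebraMap K Kt k) := fun k => by
    simp [ι, IsScalarTower.algebraMap_apply K Kt E]
  -- conjugates lie in Kt
  have hrange : ∀ i, ∃ x : Kt, algebraMap Kt E x = e i α := by
    intro i
    have h1 := hGal.to_normal.splits (algebraMap K Kt α)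
    rw [minpoly.algebraMap_eq (algebraMap K Kt).injective] at h1
    have h2 : minpoly ℚ (e i α) = minpoly ℚ α := minpoly.algHom_eq _ (e i).injective _
    rw [← h2] at h1
    exact (IsIntegral.map (e i) (Algebra.IsIntegral.isIntegral α)).mem_range_algebraMap_of_minpoly_splits h1
  choose x hx using hrange
  have hx0 : x 0 = algebraMap K Kt α := by
    apply (algebraMap Kt E).injective
    rw [hx, he0, hι]
  have hne : ∀ i j, i ≠ j → x i ≠ x j := by
    intro i j hij h
    apply hij
    apply e.injective
    apply pb.algHom_ext
    rw [← hα, ← hx, ← hx, h]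
  have htr : ∀ k, algebraMap ℚ E (Algebra.trace ℚ K k) = e 0 k + e 1 k + e 2 k := by
    intro k
    rw [trace_eq_sum_embeddings E, ← e.sum_comp, Fin.sum_univ_three]
  have hratE : ∀ q : ℚ, algebraMap ℚ E q = algebraMap Kt E (algebraMap K Kt (algebraMap ℚ K q)) := by
    intro q; simp
  have ht1 : x 0 + x 1 + x 2 = algebraMap K Kt (algebraMap ℚ K (Algebra.trace ℚ K α)) := by
    apply (algebraMap Kt E).injective
    rw [← hratE, htr]; simp [hx]
  have ht2 : x 0 ^ 2 + x 1 ^ 2 + x 2 ^ 2 =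
      algebraMap K Kt (algebraMap ℚ K (Algebra.trace ℚ K (α ^ 2))) := by
    apply (algebraMap Kt E).injective
    rw [← hratE, htr]; simp [hx]
  set Δ : Kt := (x 1 - x 0) * (x 2 - x 0) * (x 2 - x 1) with hΔ
  have hΔ0 : Δ ≠ 0 := by
    refine mul_ne_zero (mul_ne_zero ?_ ?_) ?_ <;> exact sub_ne_zero.2 (hne _ _ (by decide))
  have hdisc : algebraMap ℚ Kt (Algebra.discr ℚ b) = Δ ^ 2 := by
    apply (algebraMap Kt E).injective
    rw [← IsScalarTower.algebraMap_apply, Algebra.discr_eq_det_embeddingsMatrixReindex_pow_two ℚ E b e,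
      Matrix.det_fin_three]
    simp [Algebra.embeddingsMatrixReindex, Algebra.embeddingsMatrix, hb, hΔ, hx]
    ring
  obtain ⟨q, hq⟩ : ∃ q : ℚ, ((discr K : ℤ) : ℚ) = q ^ 2 * Algebra.discr ℚ b := by
    have hc : Fintype.card (Module.Free.ChooseBasisIndex ℤ (𝓞 K)) = 3 := by
      rw [← Module.finrank_eq_card_basis (integralBasis K), hK3]
    let b' : Module.Basis (Fin 3) ℚ K := (integralBasis K).reindex (Fintype.equivFinOfCardEq hc)
    refine ⟨(b.toMatrix b').det, ?_⟩
    rw [coe_discr, ← Algebra.discr_of_matrix_vecMul, Module.Basis.toMatrix_map_vecMul]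
    rw [← Algebra.discr_reindex ℚ _ (Fintype.equivFinOfCardEq hc)]
    congr 1
    ext i
    simp [b']
  have hq0 : q ≠ 0 := by
    rintro rfl
    have := discr_ne_zero K
    simp at hq
    exact this hq
  refine ⟨algebraMap ℚ Kt q * Δ, ?_, ?_⟩
  · have := congrArg (algebraMap ℚ Kt) hq
    rw [map_mul, hdisc, map_pow] at this
    rw [mul_pow, ← this]; simp
  · rintro ⟨k, hk⟩
    apply hKnotGal
    set f := algebraMap K Kt with hf
    have hf2 : f 2 = 2 := map_ofNat f 2
    have hfq : algebraMap ℚ Kt q = f (algebraMap ℚ K q) := by simp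
    -- everything lies in K
    have key : ∃ d : K, f d = x 2 - x 1 := by
      set t1 := algebraMap ℚ K (Algebra.trace ℚ K α)
      set t2 := algebraMap ℚ K (Algebra.trace ℚ K (α ^ 2))
      let s := t1 - α
      let r := (s ^ 2 - (t2 - α ^ 2)) / 2
      let c := r - α * s + α ^ 2
      have hs : f s = x 1 + x 2 := by
        simp only [s, map_sub]; rw [← ht1, ← hx0]; ring
      have hr : f r = x 1 * x 2 := by
        simp only [r, map_div₀, map_sub, map_pow, hs, hf2]; rw [← ht2, ← hx0]; ring
      have hc : f c = (x 1 - x 0) * (x 2 - x 0) := by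
        simp only [c, map_sub, map_add, map_mul, map_pow, hs, hr, ← hx0]; ring
      have hcne : f c ≠ 0 := by
        rw [hc]
        refine mul_ne_zero ?_ ?_ <;> exact sub_ne_zero.2 (hne _ _ (by decide))
      have hqq : f (algebraMap ℚ K q) ≠ 0 := by simpa using hq0
      refine ⟨k / (algebraMap ℚ K q * c), ?_⟩
      rw [map_div₀, hk, map_mul, div_eq_iff (mul_ne_zero hqq hcne), hc, hfq, hΔ]
      ring
    obtain ⟨d, hd⟩ := key
    have hall : ∀ i, ∃ y : K, f y = x i := by
      intro i
      set t1 := algebraMap ℚ K (Algebra.trace ℚ K α)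
      fin_cases i
      · exact ⟨α, hx0.symm⟩
      · refine ⟨(t1 - α - d) / 2, ?_⟩
        change _ = x 1
        simp only [map_div₀, map_sub, hd, hf2]; rw [← ht1, ← hx0]; ring
      · refine ⟨(t1 - α + d) / 2, ?_⟩
        change _ = x 2
        simp only [map_div₀, map_sub, map_add, hd, hf2]; rw [← ht1, ← hx0]; ring
    choose y hy using hall
    have hroot : ∀ i, Polynomial.aeval (y i) (minpoly ℚ pb.gen) = 0 := by
      intro i
      apply (show Function.Injective ι from ι.injective)
      rw [← Polynomial.aeval_algHom_apply, hι, hy, hx, Polynomial.aeval_algHom_apply,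
        minpoly.aeval]
      simp
    let g : Fin 3 → (K →ₐ[ℚ] K) := fun i => pb.lift (y i) (hroot i)
    have hg : Function.Injective g := by
      intro i j hij
      by_contra hne'
      apply hne i j hne'
      rw [← hy, ← hy]
      congr 1
      have := congrArg (fun φ : K →ₐ[ℚ] K => φ pb.gen) hij
      simpa [g] using this
    apply IsGalois.of_card_aut_eq_finrank
    apply le_antisymm
    · rw [Nat.card_eq_fintype_card]
      exact AlgEquiv.card_le
    · rw [hK3, Nat.card_congr (algEquivEquivAlgHom ℚ K).toEquiv, Nat.card_eq_fintype_card]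
      simpa using Fintype.card_le_of_injective g hg

lemma two_mul_mem_different
    (K Kt : Type) [Field K] [NumberField K] [Field Kt] [NumberField Kt]
    [Algebra K Kt] (h2 : Module.finrank K Kt = 2)
    (z : 𝓞 Kt) (a : 𝓞 K) (hz : z ^ 2 = algebraMap (𝓞 K) (𝓞 Kt) a)
    (hzK : (z : Kt) ∉ Set.range (algebraMap K Kt)) :
    2 * z ∈ differentIdeal (𝓞 K) (𝓞 Kt) := by
  have hz' : (z : Kt) ^ 2 = algebraMap K Kt (a : K) := by
    have := congrArg (algebraMap (𝓞 Kt) Kt) hz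
    rw [map_pow] at this
    rw [this, ← IsScalarTower.algebraMap_apply, ← IsScalarTower.algebraMap_apply]
  have hint : IsIntegral K (z : Kt) := Algebra.IsIntegral.isIntegral _
  have hdeg : 2 ≤ (minpoly K (z : Kt)).natDegree :=
    (minpoly.two_le_natDegree_iff hint).2 (by simpa using hzK)
  have hmin : minpoly K (z : Kt) = Polynomial.X ^ 2 - Polynomial.C (a : K) := by
    symm
    apply Polynomial.eq_of_monic_of_dvd_of_natDegree_le (minpoly.monic hint)
      (Polynomial.monic_X_pow_sub_C _ two_ne_zero)
    · apply minpoly.dvd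
      simp [hz']
    · rw [Polynomial.natDegree_X_pow_sub_C]; exact hdeg
  have hmin' : minpoly (𝓞 K) z = Polynomial.X ^ 2 - Polynomial.C a := by
    apply Polynomial.map_injective (algebraMap (𝓞 K) K) (IsFractionRing.injective _ _)
    rw [← minpoly.isIntegrallyClosed_eq_field_fractions K Kt (Algebra.IsIntegral.isIntegral z), hmin]
    simp
  have htop : Algebra.adjoin K {algebraMap (𝓞 Kt) Kt z} = ⊤ := by
    have : IntermediateField.adjoin K {(z : Kt)} = ⊤ := by
      rw [Field.primitive_element_iff_minpoly_natDegree_eq, hmin, h2,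
        Polynomial.natDegree_X_pow_sub_C]
    rw [← IntermediateField.adjoin_simple_toSubalgebra_of_isAlgebraic
      (Algebra.IsAlgebraic.isAlgebraic _), this]
    rfl
  have := aeval_derivative_mem_differentIdeal (𝓞 K) K Kt z htop
  rw [hmin'] at this
  simp [Algebra.smul_def] at this
  first | exact this | rwa [one_add_one_eq_two] at this

lemma absNorm_two_mul_sq (Kt : Type) [Field Kt] [NumberField Kt]
    (hKt6 : Module.finrank ℚ Kt = 6) (x : 𝓞 Kt) (n : ℤ) (hx : x ^ 2 = (n : 𝓞 Kt)) :
    (Ideal.absNorm (Ideal.span {2 * x})) ^ 2 = (4 * n).natAbs ^ 6 := by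
  rw [← map_pow, Ideal.span_singleton_pow, mul_pow, hx, Ideal.absNorm_span_singleton]
  have : (2 ^ 2 * (n : 𝓞 Kt)) = algebraMap ℤ (𝓞 Kt) (4 * n) := by
    simp; norm_num
  rw [this, Algebra.norm_algebraMap, RingOfIntegers.rank, hKt6, Int.natAbs_pow]

lemma exists_sq_dvd (K : Type) [Field K] [NumberField K] (p : ℕ) (hp : p.Prime)
    (h : (p : ℤ) ∣ discr K) : ∃ P : Ideal (𝓞 K), P.IsPrime ∧ (p : 𝓞 K) ∈ P ∧
      P ^ 2 ∣ Ideal.span {(p : 𝓞 K)} := by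
  have hpZ : Prime (p : ℤ) := Nat.prime_iff_prime_int.1 hp
  by_contra! hcon
  refine (not_dvd_discr_iff_forall_mem K (𝓞 K) hpZ).2 ?_ h
  intro P hP hpP
  rw [Int.cast_natCast] at hpP
  have hlies : P.LiesOver (Ideal.span {(p : ℤ)}) :=
    (Ideal.liesOver_span_iff hP.ne_top hpZ).mpr (by simpa using hpP)
  have hmap : (Ideal.span {(p : ℤ)}).map (algebraMap ℤ (𝓞 K)) = Ideal.span {(p : 𝓞 K)} := by
    simp [Ideal.map_span]
  have hne : (Ideal.span {(p : ℤ)}).map (algebraMap ℤ (𝓞 K)) ≠ ⊥ := by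
    rw [hmap]; simpa using hp.ne_zero
  rw [← Ideal.ramificationIdx_eq_one_iff,
    Ideal.IsDedekindDomain.ramificationIdx_eq_multiplicity (Ideal.span {(p : ℤ)}) P hne, hmap]
  have h1 := hcon P hP hpP
  have h2 : P ^ 1 ∣ Ideal.span {(p : 𝓞 K)} := by
    rw [pow_one, Ideal.dvd_span_singleton]; exact hpP
  exact multiplicity_eq_of_dvd_of_not_dvd h2 h1

lemma exists_odd_ramification (K : Type) [Field K] [NumberField K]
    (hK3 : Module.finrank ℚ K = 3) (p : ℕ) (hp : p.Prime) :
    ∃ P : Ideal (𝓞 K), P.IsPrime ∧ P.LiesOver (Ideal.span {(p : ℤ)}) ∧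
      Odd (P.ramificationIdx ℤ) := by
  classical
  have hpZ : Prime (p : ℤ) := Nat.prime_iff_prime_int.1 hp
  have hpr : (Ideal.span {(p : ℤ)}).IsPrime :=
    (Ideal.span_singleton_prime hpZ.ne_zero).2 hpZ
  have hmax : (Ideal.span {(p : ℤ)}).IsMaximal :=
    hpr.isMaximal (by simpa using hp.ne_zero)
  have : Finite ((Ideal.span {(p : ℤ)}).primesOver (𝓞 K)) := inferInstance
  let := Fintype.ofFinite ((Ideal.span {(p : ℤ)}).primesOver (𝓞 K))
  have hsum := Ideal.sum_ramification_inertia_eq_finrank (Ideal.span {(p : ℤ)}) (𝓞 K)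
  rw [RingOfIntegers.rank, hK3] at hsum
  by_contra! hcon
  have : Even (3 : ℕ) := by
    rw [← hsum]
    apply Finset.even_sum
    intro q _
    have := hcon q.1 q.2.1 q.2.2
    exact (Nat.not_odd_iff_even.1 this).mul_right _
  exact absurd this (by decide)

lemma lower
    (K Kt : Type) [Field K] [NumberField K] [Field Kt] [NumberField Kt]
    [Algebra K Kt] (hK3 : Module.finrank ℚ K = 3)
    (p : ℕ) (hp : p.Prime) (w : ℤ) (hw : ¬ (p : ℤ) ∣ w) (y : 𝓞 Kt)
    (hy : y ^ 2 = (((p : ℤ) * w : ℤ) : 𝓞 Kt)) :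
    p ∣ Ideal.absNorm (differentIdeal (𝓞 K) (𝓞 Kt)) := by
  have hpZ : Prime (p : ℤ) := Nat.prime_iff_prime_int.1 hp
  obtain ⟨P, hP, hPp, hodd⟩ := exists_odd_ramification K hK3 p hp
  have hPne : P ≠ ⊥ := by
    apply Ideal.ne_bot_of_liesOver_of_ne_bot (p := Ideal.span {(p : ℤ)})
    simpa using hp.ne_zero
  have hPmax : P.IsMaximal := hP.isMaximal hPne
  obtain ⟨Q, hQ, hQP⟩ := Ideal.exists_maximal_ideal_liesOver_of_isIntegral (S := 𝓞 Kt) P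
  have hQp : Q.LiesOver (Ideal.span {(p : ℤ)}) := Ideal.LiesOver.trans Q P _
  have hQpr : Q.IsPrime := hQ.isPrime
  have hpQ : (p : 𝓞 Kt) ∈ Q := by
    have := (Ideal.liesOver_span_iff hQpr.ne_top hpZ).mp hQp
    simpa using this
  have hQne : Q ≠ ⊥ := by
    rintro rfl
    simp at hpQ
    exact hp.ne_zero hpQ
  have hQprime : Prime Q := Ideal.prime_of_isPrime hQne hQpr
  have hmap : (Ideal.span {(p : ℤ)}).map (algebraMap ℤ (𝓞 Kt)) = Ideal.span {(p : 𝓞 Kt)} := by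
    simp [Ideal.map_span]
  have hne : (Ideal.span {(p : ℤ)}).map (algebraMap ℤ (𝓞 Kt)) ≠ ⊥ := by
    rw [hmap]; simpa using hp.ne_zero
  have hw0 : w ≠ 0 := by rintro rfl; simp at hw
  have hwQ : ¬ Q ∣ Ideal.span {(w : 𝓞 Kt)} := by
    rw [Ideal.dvd_span_singleton]
    intro h
    apply hw
    have h1 : w ∈ Q.under ℤ := by simpa [Ideal.under_def, Ideal.mem_comap] using h
    rw [← hQp.over, Ideal.mem_span_singleton] at h1
    exact h1
  have heven : Even (Q.ramificationIdx ℤ) := by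
    rw [Ideal.IsDedekindDomain.ramificationIdx_eq_multiplicity (Ideal.span {(p : ℤ)}) Q hne, hmap]
    have h1 : Ideal.span {y} ^ 2 = Ideal.span {(p : 𝓞 Kt)} * Ideal.span {(w : 𝓞 Kt)} := by
      rw [Ideal.span_singleton_pow, hy, Ideal.span_singleton_mul_span_singleton]; simp
    have hne2 : Ideal.span {y} ^ 2 ≠ 0 := by
      rw [h1]
      apply mul_ne_zero
      · simpa using hp.ne_zero
      · simpa using hw0
    have hfin : FiniteMultiplicity Q (Ideal.span {y} ^ 2) :=
      FiniteMultiplicity.of_prime_left hQprime hne2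
    have hfin1 : FiniteMultiplicity Q (Ideal.span {y}) :=
      FiniteMultiplicity.of_prime_left hQprime (fun h => hne2 (by rw [h]; simp))
    have h2 := hfin1.multiplicity_pow hQprime (k := 2)
    rw [h1, multiplicity_mul hQprime (h1 ▸ hfin), multiplicity_eq_zero.2 hwQ] at h2
    exact ⟨multiplicity Q (Ideal.span {y}), by omega⟩
  rw [Ideal.ramificationIdx_tower P Q] at heven
  have hram : Q.ramificationIdx (𝓞 K) ≠ 1 := by
    intro h
    rw [h, mul_one] at heven
    exact (Nat.not_even_iff_odd.2 hodd) heven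
  have hdvd : Q ∣ differentIdeal (𝓞 K) (𝓞 Kt) := by
    rw [dvd_differentIdeal_iff]
    intro h
    exact hram (Ideal.ramificationIdx_eq_one Q (𝓞 K))
  have h3 := Ideal.absNorm_dvd_absNorm_of_le (Ideal.dvd_iff_le.mp hdvd)
  refine dvd_trans ?_ h3
  have h4 : (Ideal.absNorm Q : 𝓞 Kt) ∈ Q := Ideal.absNorm_mem Q
  have h5 : (Ideal.absNorm Q : ℤ) ∈ Q.under ℤ := by simpa [Ideal.under_def, Ideal.mem_comap] using h4
  rw [← hQp.over, Ideal.mem_span_singleton] at h5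
  exact_mod_cast h5

lemma not_dvd_four_mul (p : ℕ) (hp : p.Prime) (hodd : Odd p) (w : ℤ) (hw : ¬ (p : ℤ) ∣ w) :
    ¬ p ∣ 4 * w.natAbs := by
  intro h
  rcases hp.dvd_mul.1 h with h | h
  · have h2 : p ∣ 2 := hp.dvd_of_dvd_pow (show p ∣ 2 ^ 2 by simpa using h)
    rw [Nat.prime_dvd_prime_iff_eq hp Nat.prime_two] at h2
    subst h2
    exact absurd hodd (by decide)
  · exact hw (Int.natCast_dvd.2 h)

lemma upper
    (K Kt : Type) [Field K] [NumberField K] [Field Kt] [NumberField Kt]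
    [Algebra K Kt] (h2 : Module.finrank K Kt = 2) (hKt6 : Module.finrank ℚ Kt = 6)
    (p : ℕ) (hp : p.Prime) (hodd : Odd p)
    (hdK : (p : ℤ) ∣ discr K) (w : ℤ) (hw : ¬ (p : ℤ) ∣ w) (y : 𝓞 Kt)
    (hy : y ^ 2 = (((p : ℤ) * w : ℤ) : 𝓞 Kt))
    (hyK : (y : Kt) ∉ Set.range (algebraMap K Kt)) :
    ¬ p ^ 2 ∣ Ideal.absNorm (differentIdeal (𝓞 K) (𝓞 Kt)) := by
  obtain ⟨P, hP, hpP, A, hA⟩ := exists_sq_dvd K p hp hdK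
  set D := differentIdeal (𝓞 K) (𝓞 Kt) with hD
  set φ := algebraMap (𝓞 K) (𝓞 Kt) with hφ
  have hp0 : (p : 𝓞 Kt) ≠ 0 := by simpa using hp.ne_zero
  -- elements of `P * A`
  have hmem : ∀ b ∈ P * A, 2 * y * φ b ∈ Ideal.span {(p : 𝓞 Kt)} * D := by
    intro b hb
    by_cases hb0 : b = 0
    · simp [hb0]
    have hb2 : b ^ 2 ∈ Ideal.span {(p : 𝓞 K)} * A := by
      rw [hA, show P ^ 2 * A * A = (P * A) * (P * A) by ring, sq b]
      exact Ideal.mul_mem_mul hb hb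
    obtain ⟨a, -, ha⟩ := Ideal.mem_span_singleton_mul.1 hb2
    have hz2 : ((φ b : Kt) * y / p) ^ 2 = ((φ (a * w) : 𝓞 Kt) : Kt) := by
      have hp0' : (p : Kt) ≠ 0 := by simpa using hp.ne_zero
      have h1 : (φ b : Kt) ^ 2 = p * (φ a : Kt) := by
        rw [← map_pow, ← map_pow, ← ha]; simp
      have h3 : (y : Kt) ^ 2 = p * w := by
        rw [← map_pow, hy]; simp
      have h4 : ((φ (a * w) : 𝓞 Kt) : Kt) = (φ a : Kt) * w := by
        change algebraMap (𝓞 Kt) Kt (φ (a * w)) = algebraMap (𝓞 Kt) Kt (φ a) * w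
        rw [map_mul φ, map_mul, map_intCast, map_intCast]
      rw [div_pow, mul_pow, h1, h3, h4, div_eq_iff (pow_ne_zero _ hp0')]
      ring
    have hint : IsIntegral ℤ ((φ b : Kt) * y / p) := by
      refine IsIntegral.of_pow (n := 2) two_pos ?_
      rw [hz2]; exact RingOfIntegers.isIntegral_coe _
    let z : 𝓞 Kt := ⟨(φ b : Kt) * y / p, hint⟩
    have hz : (z : Kt) = (φ b : Kt) * y / p := rfl
    have hzp : (p : 𝓞 Kt) * z = φ b * y := by
      apply RingOfIntegers.ext
      have hp0' : (p : Kt) ≠ 0 := by simpa using hp.ne_zero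
      change algebraMap (𝓞 Kt) Kt (p * z) = algebraMap (𝓞 Kt) Kt (φ b * y)
      rw [map_mul, map_mul, map_natCast]
      change (p : Kt) * ((φ b : Kt) * y / p) = (φ b : Kt) * y
      field_simp
    have hφb : (φ b : Kt) = algebraMap K Kt (b : K) := by
      exact (IsScalarTower.algebraMap_apply (𝓞 K) (𝓞 Kt) Kt b).symm.trans
        (IsScalarTower.algebraMap_apply (𝓞 K) K Kt b)
    have hzD : 2 * z ∈ D := by
      apply two_mul_mem_different K Kt h2 z (a * w)
      · apply RingOfIntegers.ext
        refine Eq.trans ?_ hz2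
        exact map_pow (algebraMap (𝓞 Kt) Kt) z 2
      · rintro ⟨k, hk⟩
        apply hyK
        refine ⟨k * p / b, ?_⟩
        have hb0' : (φ b : Kt) ≠ 0 := by
          rw [hφb]; simpa using hb0
        have hp0' : (p : Kt) ≠ 0 := by simpa using hp.ne_zero
        rw [map_div₀, map_mul, hk, hz, ← hφb, map_natCast]
        field_simp
    rw [show 2 * y * φ b = p * (2 * z) by linear_combination -2 * hzp]
    exact Ideal.mul_mem_mul (Ideal.mem_span_singleton_self _) hzD
  have hle : Ideal.span {(p : 𝓞 Kt)} * D ∣ Ideal.span {2 * y} * (P * A).map φ := by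
    rw [Ideal.dvd_iff_le, Ideal.span_singleton_mul_le_iff]
    intro c hc
    induction hc using Submodule.span_induction with
    | mem x hx =>
      obtain ⟨b, hb, rfl⟩ := hx
      exact hmem b hb
    | zero => simp
    | add u v _ _ hu hv => rw [mul_add]; exact add_mem hu hv
    | smul a u _ hu =>
      rw [smul_eq_mul, mul_left_comm]
      exact Ideal.mul_mem_left _ _ hu
  -- multiply by `P`
  have hle2 : D * P.map φ ∣ Ideal.span {2 * y} := by
    have h1 := mul_dvd_mul_right hle (P.map φ)
    have h3 : (P * A).map φ * P.map φ = Ideal.span {(p : 𝓞 Kt)} := by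
      rw [← Ideal.map_mul, show P * A * P = P ^ 2 * A by ring, ← hA, Ideal.map_span]
      simp
    rw [mul_assoc, mul_assoc, h3, mul_comm (Ideal.span {2 * y})] at h1
    exact (mul_dvd_mul_iff_left (by simpa using hp.ne_zero)).1 h1
  have hN := map_dvd Ideal.absNorm hle2
  rw [map_mul, hφ, Ideal.absNorm_algebraMap, ← IsFractionRing.finrank_eq (𝓞 K) K (𝓞 Kt) Kt, h2] at hN
  have hpN : p ∣ Ideal.absNorm P := by
    have hpZ : Prime (p : ℤ) := Nat.prime_iff_prime_int.1 hp
    have hlies : P.LiesOver (Ideal.span {(p : ℤ)}) :=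
      (Ideal.liesOver_span_iff hP.ne_top hpZ).mpr (by simpa using hpP)
    have h4 : (Ideal.absNorm P : 𝓞 K) ∈ P := Ideal.absNorm_mem P
    have h5 : (Ideal.absNorm P : ℤ) ∈ P.under ℤ := by
      simpa [Ideal.under_def, Ideal.mem_comap] using h4
    rw [← hlies.over, Ideal.mem_span_singleton] at h5
    exact_mod_cast h5
  intro hcon
  have h8 : p ^ 4 ∣ Ideal.absNorm (Ideal.span {2 * y}) := by
    refine dvd_trans ?_ hN
    rw [show p ^ 4 = p ^ 2 * p ^ 2 by ring]
    exact mul_dvd_mul hcon (pow_dvd_pow_of_dvd hpN 2)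
  have h9 := pow_dvd_pow_of_dvd h8 2
  rw [absNorm_two_mul_sq Kt hKt6 y _ hy, Int.natAbs_mul, Int.natAbs_mul, Int.natAbs_natCast] at h9
  have h10 : p ^ 6 * p ^ 2 ∣ p ^ 6 * (4 * w.natAbs) ^ 6 := by
    rw [show (p ^ 4) ^ 2 = p ^ 6 * p ^ 2 by ring,
      show (Int.natAbs 4 * (p * w.natAbs)) ^ 6 = p ^ 6 * (4 * w.natAbs) ^ 6 by
        rw [show Int.natAbs 4 = 4 from rfl]; ring] at h9
    exact h9
  have h11 := (Nat.mul_dvd_mul_iff_left (pow_pos hp.pos 6)).1 h10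
  have h12 : p ∣ 4 * w.natAbs := hp.dvd_of_dvd_pow (dvd_trans (dvd_pow_self p two_ne_zero) h11)
  exact not_dvd_four_mul p hp hodd w hw h12

lemma even_case
    (K Kt : Type) [Field K] [NumberField K] [Field Kt] [NumberField Kt]
    [Algebra K Kt] (h2 : Module.finrank K Kt = 2) (hKt6 : Module.finrank ℚ Kt = 6)
    (p : ℕ) (hp : p.Prime) (hodd : Odd p)
    (w : ℤ) (hw : ¬ (p : ℤ) ∣ w) (y : 𝓞 Kt)
    (hy : y ^ 2 = (w : 𝓞 Kt))
    (hyK : (y : Kt) ∉ Set.range (algebraMap K Kt)) :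
    ¬ p ∣ Ideal.absNorm (differentIdeal (𝓞 K) (𝓞 Kt)) := by
  intro hcon
  have h1 := two_mul_mem_different K Kt h2 y w (by simpa using hy) hyK
  rw [← Ideal.dvd_span_singleton] at h1
  have h3 := dvd_pow (hcon.trans (map_dvd Ideal.absNorm h1)) two_ne_zero
  rw [absNorm_two_mul_sq Kt hKt6 y _ hy, Int.natAbs_mul] at h3
  exact not_dvd_four_mul p hp hodd w hw (hp.dvd_of_dvd_pow h3)

theorem disc_valuation_odd_prime
    (K Kt : Type) [Field K] [NumberField K] [Field Kt] [NumberField Kt]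
    [Algebra K Kt] [IsScalarTower ℚ K Kt]
    (hK3 : Module.finrank ℚ K = 3) (hKnotGal : ¬IsGalois ℚ K)
    (hGal : IsGalois ℚ Kt) (hKt6 : Module.finrank ℚ Kt = 6)
    (p : ℕ) (hp : p.Prime) (hodd : Odd p) :
    (Even (padicValInt p (NumberField.discr K)) →
      padicValInt p (NumberField.discr Kt) =
        2 * padicValInt p (NumberField.discr K)) ∧
    (Odd (padicValInt p (NumberField.discr K)) →
      padicValInt p (NumberField.discr Kt) =
        2 * padicValInt p (NumberField.discr K) + 1) := by
  have : Fact p.Prime := ⟨hp⟩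
  have h2 : Module.finrank K Kt = 2 := by
    have := Module.finrank_mul_finrank ℚ K Kt
    rw [hK3, hKt6] at this
    omega
  obtain ⟨δ, hδ, hδK⟩ := exists_sqrt_discr K Kt hK3 hKnotGal hGal
  set M := Ideal.absNorm (differentIdeal (𝓞 K) (𝓞 Kt)) with hM
  have hform : (discr Kt).natAbs = M * (discr K).natAbs ^ 2 := by
    rw [← h2]
    exact natAbs_discr_eq_absNorm_differentIdeal_mul_natAbs_discr_pow K (𝓞 K) Kt (𝓞 Kt)
  have hdK0 : (discr K).natAbs ≠ 0 := Int.natAbs_ne_zero.2 (discr_ne_zero K)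
  have hM0 : M ≠ 0 := by
    intro h
    rw [h, zero_mul] at hform
    exact discr_ne_zero Kt (Int.natAbs_eq_zero.1 hform)
  have hval : padicValInt p (discr Kt) = padicValNat p M + 2 * padicValInt p (discr K) := by
    rw [padicValInt, padicValInt, hform, padicValNat.mul hM0 (pow_ne_zero _ hdK0),
      padicValNat.pow]
  obtain ⟨w, hw⟩ : (p : ℤ) ^ padicValInt p (discr K) ∣ discr K := padicValInt_dvd _
  have hpw : ¬ (p : ℤ) ∣ w := by
    rintro ⟨u, rfl⟩
    have : (p : ℤ) ^ (padicValInt p (discr K) + 1) ∣ discr K := ⟨u, by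
      rw [pow_succ, mul_assoc]; exact hw⟩
    rw [padicValInt_dvd_iff] at this
    rcases this with h | h
    · exact discr_ne_zero K h
    · omega
  have hp0 : (p : Kt) ≠ 0 := by simpa using hp.ne_zero
  -- dividing the square root by a power of `p`
  have hdiv : ∀ (m : ℕ) (n : ℤ), discr K = (p : ℤ) ^ (2 * m) * n →
      ∃ y : 𝓞 Kt, y ^ 2 = (n : 𝓞 Kt) ∧ (y : Kt) ∉ Set.range (algebraMap K Kt) := by
    intro m n hn
    have hsq : (δ / (p : Kt) ^ m) ^ 2 = ((n : 𝓞 Kt) : Kt) := by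
      rw [div_pow, hδ, hn, div_eq_iff (pow_ne_zero _ (pow_ne_zero _ hp0))]
      push_cast; simp; ring
    have hint : IsIntegral ℤ (δ / (p : Kt) ^ m) := by
      refine IsIntegral.of_pow (n := 2) two_pos ?_
      rw [hsq]; exact RingOfIntegers.isIntegral_coe _
    refine ⟨⟨_, hint⟩, ?_, ?_⟩
    · apply RingOfIntegers.ext
      refine Eq.trans ?_ hsq
      exact map_pow (algebraMap (𝓞 Kt) Kt) _ 2
    · rintro ⟨k, hk⟩
      apply hδK
      refine ⟨k * p ^ m, ?_⟩
      rw [map_mul, hk, map_pow, map_natCast]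
      change δ / (p : Kt) ^ m * p ^ m = δ
      field_simp
  constructor
  · rintro ⟨m, hm⟩
    obtain ⟨y, hy, hyK⟩ := hdiv m w (by rw [hw, hm] ; congr 2; ring)
    have := even_case K Kt h2 hKt6 p hp hodd w hpw y hy hyK
    rw [hval, padicValNat.eq_zero_of_not_dvd this, zero_add]
  · rintro ⟨m, hm⟩
    obtain ⟨y, hy, hyK⟩ := hdiv m (p * w) (by rw [hw, hm]; ring)
    have hdvd : (p : ℤ) ∣ discr K := by
      rw [hw, hm]; exact Dvd.dvd.mul_right (dvd_pow_self _ (by omega)) _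
    have hlow := lower K Kt hK3 p hp w hpw y hy
    have hup := upper K Kt h2 hKt6 p hp hodd hdvd w hpw y hy hyK
    have hMv : padicValNat p M = 1 := by
      apply le_antisymm
      · by_contra! h
        exact hup ((padicValNat_dvd_iff_le hM0).2 h)
      · exact one_le_padicValNat_of_dvd hM0 hlow
    rw [hval, hMv, add_comm]
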